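/- Let R be an integral domain. Then R is a PvMD if and only if for every finitely generated R-module M, the canonical short exact sequence 0 → T(M) → M →π→ M/T(M) → 0 (where T(M) is the torsion submodule) w-splits: there exists a GV-ideal J such that for every d ∈ J there is an R-homomorphism h : M/T(M) → M with π ∘ h = d·id. -/

import Mathlib

open TensorProduct

/-- A finitely generated ideal `J` is a GV-ideal if the natural map
`R → Hom_R(J, R)`, sending `r` to multiplication by `r`, is bijective. -/
def IsGVIdeal {R : Type*} [CommRing R] (J : Ideal R) : Prop :=
  J.FG ∧ Function.Bijective fun r : R => (r • J.subtype : J →ₗ[R] R)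

/-- `R` is a PvMD if for every nonzero finitely generated ideal `I` of `R` there is a
GV-ideal `J` with `J ⊆ I·I⁻¹` (inside the quotient field `K`). -/
def IsPvMD (R : Type*) [CommRing R] [IsDomain R] (K : Type*) [Field K] [Algebra R K]
    [IsFractionRing R K] : Prop :=
  ∀ I : Ideal R, I ≠ ⊥ → I.FG →
    ∃ J : Ideal R, IsGVIdeal J ∧
      (J : FractionalIdeal (nonZeroDivisors R) K) ≤
        (I : FractionalIdeal (nonZeroDivisors R) K) *
          (I : FractionalIdeal (nonZeroDivisors R) K)⁻¹

universe u v

namespace IsGVIdeal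

variable {R : Type*} [CommRing R]

theorem top : IsGVIdeal (⊤ : Ideal R) := by
  refine ⟨⟨{1}, by simp [Ideal.span_singleton_one]⟩, fun r s h => ?_, fun f => ⟨f ⟨1, trivial⟩, ?_⟩⟩
  · simpa using LinearMap.congr_fun h (⟨1, trivial⟩ : (⊤ : Ideal R))
  · ext ⟨x, hx⟩
    calc f ⟨1, trivial⟩ * x = x • f ⟨1, trivial⟩ := mul_comm _ _
      _ = f (x • ⟨1, trivial⟩) := (f.map_smul x _).symm
      _ = f ⟨x, hx⟩ := congrArg f (Subtype.ext (mul_one x))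

theorem eq_of_forall_mul_eq {J : Ideal R} (hJ : IsGVIdeal J) {r s : R}
    (h : ∀ a ∈ J, r * a = s * a) : r = s :=
  hJ.2.1 (LinearMap.ext fun a => h a a.2)

theorem exists_eq_mul {J : Ideal R} (hJ : IsGVIdeal J) (f : J →ₗ[R] R) :
    ∃ r : R, ∀ a : J, f a = r * a := by
  obtain ⟨r, hr⟩ := hJ.2.2 f
  exact ⟨r, fun a => (LinearMap.congr_fun hr a).symm⟩

theorem mul {J₁ J₂ : Ideal R} (h₁ : IsGVIdeal J₁) (h₂ : IsGVIdeal J₂) :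
    IsGVIdeal (J₁ * J₂) := by
  refine ⟨Submodule.FG.mul h₁.1 h₂.1, fun r s h => ?_, fun f => ?_⟩
  · refine h₁.eq_of_forall_mul_eq fun a ha => h₂.eq_of_forall_mul_eq fun b hb => ?_
    simpa [mul_assoc] using LinearMap.congr_fun h ⟨a * b, Ideal.mul_mem_mul ha hb⟩
  · have key (a : J₁) : ∃ r : R, ∀ b : J₂,
        f ⟨a * b, Ideal.mul_mem_mul a.2 b.2⟩ = r * b := by
      refine h₂.exists_eq_mul
        { toFun := fun b => f ⟨a * b, Ideal.mul_mem_mul a.2 b.2⟩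
          map_add' := fun b c => ?_
          map_smul' := fun t b => ?_ }
      · rw [← map_add]
        congr 1
        exact Subtype.ext (mul_add _ _ _)
      · rw [← map_smul]
        congr 1
        exact Subtype.ext (mul_left_comm _ _ _)
    choose ρ hρ using key
    obtain ⟨r, hr⟩ := h₁.exists_eq_mul
      { toFun := ρ
        map_add' := fun a c => by
          refine h₂.eq_of_forall_mul_eq fun b hb => ?_
          rw [add_mul, ← hρ _ ⟨b, hb⟩, ← hρ _ ⟨b, hb⟩, ← hρ _ ⟨b, hb⟩, ← map_add]
          congr 1
          exact Subtype.ext (add_mul _ _ _)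
        map_smul' := fun t a => by
          refine h₂.eq_of_forall_mul_eq fun b hb => ?_
          rw [RingHom.id_apply, smul_eq_mul, mul_assoc, ← hρ _ ⟨b, hb⟩, ← hρ _ ⟨b, hb⟩,
            ← smul_eq_mul t, ← map_smul]
          congr 1
          exact Subtype.ext (mul_assoc _ _ _) }
    refine ⟨r, ?_⟩
    ext ⟨x, hx⟩
    induction hx using Submodule.mul_induction_on' with
    | mem_mul_mem a ha b hb =>
      have h := hρ ⟨a, ha⟩ ⟨b, hb⟩
      have h' : ρ ⟨a, ha⟩ = r * a := hr ⟨a, ha⟩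
      rw [h', mul_assoc] at h
      exact h.symm
    | add x hx y hy ihx ihy =>
      have := congrArg₂ (· + ·) ihx ihy
      simp only [← map_add] at this
      exact this

theorem prod {ι : Type*} (s : Finset ι) {J : ι → Ideal R} (h : ∀ i ∈ s, IsGVIdeal (J i)) :
    IsGVIdeal (∏ i ∈ s, J i) :=
  Finset.prod_induction J IsGVIdeal (fun _ _ => mul) (Ideal.one_eq_top (R := R) ▸ top) h

end IsGVIdeal

section DualTensorHom

variable {R : Type*} [CommRing R] {L M N P : Type*} [AddCommGroup L] [AddCommGroup M]
  [AddCommGroup N] [AddCommGroup P] [Module R L] [Module R M] [Module R N] [Module R P]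

theorem comp_mem_range_dualTensorHom (g : N →ₗ[R] P) {f : M →ₗ[R] N}
    (hf : f ∈ LinearMap.range (dualTensorHom R M N)) :
    g ∘ₗ f ∈ LinearMap.range (dualTensorHom R M P) := by
  obtain ⟨t, rfl⟩ := hf
  exact ⟨g.lTensor _ t, LinearMap.congr_fun (dualTensorHom_comp_lTensor g) t⟩

theorem mem_range_dualTensorHom_comp (g : L →ₗ[R] M) {f : M →ₗ[R] N}
    (hf : f ∈ LinearMap.range (dualTensorHom R M N)) :
    f ∘ₗ g ∈ LinearMap.range (dualTensorHom R L N) := by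
  obtain ⟨t, rfl⟩ := hf
  exact ⟨g.dualMap.rTensor _ t, LinearMap.congr_fun (dualTensorHom_comp_rTensor_dualMap g) t⟩

theorem exists_lift_of_mem_range_dualTensorHom {p : N →ₗ[R] P} (hp : Function.Surjective p)
    {f : M →ₗ[R] P} (hf : f ∈ LinearMap.range (dualTensorHom R M P)) :
    ∃ h ∈ LinearMap.range (dualTensorHom R M N), p ∘ₗ h = f := by
  obtain ⟨t, rfl⟩ := hf
  obtain ⟨t, rfl⟩ := p.lTensor_surjective _ hp t
  exact ⟨_, ⟨t, rfl⟩, (LinearMap.congr_fun (dualTensorHom_comp_lTensor p) t).symm⟩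

end DualTensorHom

/-- The ideal of scalars whose multiplication map on `M` factors through a finite free module. -/
def Module.finiteFreeScalars (R M : Type*) [CommRing R] [AddCommGroup M] [Module R M] : Ideal R :=
  (LinearMap.range (dualTensorHom R M M)).comap (LinearMap.toSpanSingleton R _ LinearMap.id)

theorem Module.mem_finiteFreeScalars {R M : Type*} [CommRing R] [AddCommGroup M] [Module R M]
    {d : R} : d ∈ Module.finiteFreeScalars R M ↔
      d • (LinearMap.id : M →ₗ[R] M) ∈ LinearMap.range (dualTensorHom R M M) :=
  Iff.rfl

theorem Module.finiteFreeScalars_eq_top_of_subsingleton {R M : Type*} [CommRing R]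
    [AddCommGroup M] [Module R M] [Subsingleton M] : Module.finiteFreeScalars R M = ⊤ :=
  Ideal.eq_top_iff_one _ |>.2 ⟨0, Subsingleton.elim _ _⟩

theorem IsPvMD.exists_isGVIdeal_le_finiteFreeScalars_ideal {R : Type*} [CommRing R] [IsDomain R]
    {K : Type*} [Field K] [Algebra R K] [IsFractionRing R K] (hR : IsPvMD R K)
    (I : Ideal R) (hI : I.FG) :
    ∃ J : Ideal R, IsGVIdeal J ∧ J ≤ Module.finiteFreeScalars R I := by
  rcases eq_or_ne I ⊥ with rfl | hI0
  · exact ⟨⊤, .top, Module.finiteFreeScalars_eq_top_of_subsingleton.ge⟩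
  obtain ⟨J, hJ, hJI⟩ := hR I hI0 hI
  refine ⟨J, hJ, fun d hd => ?_⟩
  have hinj := IsFractionRing.injective R K
  have key : ∃ f ∈ LinearMap.range (dualTensorHom R I I),
      ∀ y : I, algebraMap R K (f y) = algebraMap R K d * algebraMap R K y := by
    refine FractionalIdeal.mul_induction_on
      (C := fun x : K => ∃ f ∈ LinearMap.range (dualTensorHom R I I),
        ∀ y : I, algebraMap R K (f y) = x * algebraMap R K y)
      (hJI (FractionalIdeal.mem_coeIdeal_of_mem _ hd)) ?_ ?_
    · intro a ha x hx
      obtain ⟨a, haI, rfl⟩ := (FractionalIdeal.mem_coeIdeal _).1 ha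
      rw [FractionalIdeal.mem_inv_iff (FractionalIdeal.coeIdeal_ne_zero.2 hI0)] at hx
      have key (y : I) : ∃ r : R, algebraMap R K r = x * algebraMap R K y :=
        (FractionalIdeal.mem_one_iff _).1 (hx _ (FractionalIdeal.mem_coeIdeal_of_mem _ y.2))
      choose φ hφ using key
      let Φ : I →ₗ[R] R :=
        { toFun := φ
          map_add' := fun y z => hinj (by simp [hφ, mul_add])
          map_smul' := fun t y => hinj (by simp [hφ, mul_left_comm]) }
      refine ⟨_, ⟨Φ ⊗ₜ ⟨a, haI⟩, rfl⟩, fun y => ?_⟩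
      simp only [dualTensorHom_apply, Φ, LinearMap.coe_mk, AddHom.coe_mk, SetLike.val_smul,
        smul_eq_mul, map_mul, hφ]
      ring
    · rintro x y ⟨f, hf, hfx⟩ ⟨g, hg, hgy⟩
      exact ⟨f + g, add_mem hf hg, fun z => by simp [hfx, hgy, add_mul]⟩
  obtain ⟨f, hf, hfd⟩ := key
  rw [Module.mem_finiteFreeScalars]
  convert hf
  ext y
  exact hinj (by simp [hfd])

theorem exists_isGVIdeal_le_finiteFreeScalars_of_injective_pi {R : Type u} [CommRing R]
    (hR : ∀ I : Ideal R, I.FG → ∃ J : Ideal R, IsGVIdeal J ∧ J ≤ Module.finiteFreeScalars R I)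
    (n : ℕ) (N : Type v) [AddCommGroup N] [Module R N] [Module.Finite R N]
    (i : N →ₗ[R] Fin n → R) (hi : Function.Injective i) :
    ∃ J : Ideal R, IsGVIdeal J ∧ J ≤ Module.finiteFreeScalars R N := by
  induction n generalizing N with
  | zero =>
    have := hi.subsingleton
    exact ⟨⊤, .top, Module.finiteFreeScalars_eq_top_of_subsingleton.ge⟩
  | succ n ih =>
    let p : N →ₗ[R] R := LinearMap.proj 0 ∘ₗ i
    obtain ⟨J, hJ, hJp⟩ := hR (LinearMap.range p) (Module.Finite.iff_fg.1 inferInstance)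
    have key (d : R) : ∃ Q : Ideal R, IsGVIdeal Q ∧
        (d ∈ J → ∀ e ∈ Q, d * e ∈ Module.finiteFreeScalars R N) := by
      by_cases hd : d ∈ J
      swap
      · exact ⟨⊤, .top, fun h => absurd h hd⟩
      obtain ⟨h, hh, hph⟩ := exists_lift_of_mem_range_dualTensorHom
        p.surjective_rangeRestrict (Module.mem_finiteFreeScalars.1 (hJp hd))
      let g : N →ₗ[R] N := d • LinearMap.id - h ∘ₗ p.rangeRestrict
      have hpg (x : N) : p (g x) = 0 := by
        have := congrArg Subtype.val (LinearMap.congr_fun hph (p.rangeRestrict x))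
        simp at this
        simp [g, this]
      obtain ⟨Q, hQ, hQg⟩ := ih (LinearMap.range g)
        (LinearMap.funLeft R R Fin.succ ∘ₗ i ∘ₗ (LinearMap.range g).subtype) (by
          rw [← LinearMap.ker_eq_bot, LinearMap.ker_eq_bot']
          rintro ⟨_, x, rfl⟩ hx
          refine Subtype.ext (hi (funext fun j => ?_))
          refine Fin.cases ?_ (fun j => ?_) j
          · exact (hpg x).trans (congrFun (map_zero i) 0).symm
          · simpa using congrFun hx j)
      refine ⟨Q, hQ, fun _ e he => ?_⟩
      have h₁ := Submodule.smul_mem (LinearMap.range (dualTensorHom R N N)) e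
        (mem_range_dualTensorHom_comp p.rangeRestrict hh)
      have h₂ := comp_mem_range_dualTensorHom (LinearMap.range g).subtype
        (mem_range_dualTensorHom_comp g.rangeRestrict (Module.mem_finiteFreeScalars.1 (hQg he)))
      rw [Module.mem_finiteFreeScalars]
      convert add_mem h₁ h₂ using 1
      ext x
      simp [g, smul_sub, mul_smul, smul_comm d e]
    choose Q hQ hQd using key
    obtain ⟨s, hs⟩ := hJ.1
    refine ⟨J * ∏ d ∈ s, Q d, hJ.mul (.prod s fun d _ => hQ d), Ideal.mul_le.2 ?_⟩
    intro d hd e he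
    have hsub : J ≤ Submodule.comap (LinearMap.mulRight R e) (Module.finiteFreeScalars R N) := by
      rw [← hs, Submodule.span_le]
      intro c hc
      exact hQd c (hs ▸ Submodule.subset_span hc) e
        (Ideal.prod_le_inf.trans (Finset.inf_le hc) he)
    exact hsub hd

theorem Module.Finite.exists_injective_pi {R : Type u} [CommRing R] [IsDomain R]
    (N : Type v) [AddCommGroup N] [Module R N] [Module.Finite R N] [Module.IsTorsionFree R N] :
    ∃ (n : ℕ) (i : N →ₗ[R] Fin n → R), Function.Injective i := by
  let K := FractionRing R
  let V := LocalizedModule (nonZeroDivisors R) N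
  let l : N →ₗ[R] V := LocalizedModule.mkLinearMap (nonZeroDivisors R) N
  have hl : Function.Injective l := by
    rw [← LinearMap.ker_eq_bot, LinearMap.ker_eq_bot']
    intro x hx
    obtain ⟨c, hc⟩ := (IsLocalizedModule.eq_zero_iff (nonZeroDivisors R) l).1 hx
    exact (smul_eq_zero.1 hc).resolve_left (nonZeroDivisors.coe_ne_zero c)
  have : Module.Finite K V := Module.Finite.of_isLocalizedModule (nonZeroDivisors R) l
  let b := Module.finBasis K V
  let Φ : N →ₗ[R] Fin (Module.finrank K V) → K :=
    (b.equivFun.toLinearMap.restrictScalars R) ∘ₗ l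
  have hΦ : Function.Injective Φ := b.equivFun.injective.comp hl
  obtain ⟨m, x, hx⟩ := Module.Finite.exists_fin (R := R) (M := N)
  obtain ⟨t, ht⟩ := IsLocalization.exist_integer_multiples_of_finite (nonZeroDivisors R)
    (fun a : Fin m × Fin (Module.finrank K V) => Φ (x a.1) a.2)
  let A : (Fin (Module.finrank K V) → R) →ₗ[R] Fin (Module.finrank K V) → K :=
    (Algebra.linearMap R K).compLeft _
  have hA : Function.Injective A := (IsFractionRing.injective R K).comp_left
  have hmem (y : N) : ((t : R) • Φ) y ∈ LinearMap.range A := by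
    have : (⊤ : Submodule R N) ≤ (LinearMap.range A).comap ((t : R) • Φ) := by
      rw [← hx, Submodule.span_le]
      rintro _ ⟨a, rfl⟩
      choose r hr using fun j => ht (a, j)
      exact ⟨r, funext hr⟩
    exact this trivial
  let e := LinearEquiv.ofInjective A hA
  refine ⟨_, e.symm.toLinearMap ∘ₗ
    LinearMap.codRestrict _ ((t : R) • Φ) hmem, ?_⟩
  refine e.symm.injective.comp fun y z h => hΦ ?_
  have h' : (t : R) • Φ y = (t : R) • Φ z := congrArg Subtype.val h
  exact smul_right_injective _ (nonZeroDivisors.coe_ne_zero t) h'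

theorem isPvMD_of_canonical_sequence_wsplits {R : Type u} [CommRing R] [IsDomain R]
    {K : Type*} [Field K] [Algebra R K] [IsFractionRing R K]
    (H : ∀ (M : Type u) [AddCommGroup M] [Module R M] [Module.Finite R M],
        ∃ J : Ideal R, IsGVIdeal J ∧
          ∀ d ∈ J, ∃ h : (M ⧸ Submodule.torsion R M) →ₗ[R] M,
            (Submodule.torsion R M).mkQ ∘ₗ h = d • LinearMap.id) :
    IsPvMD R K := by
  intro I hI0 hI
  obtain ⟨k, g, hg⟩ := Submodule.fg_iff_exists_fin_generating_family.1 hI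
  obtain ⟨a, haI, ha0⟩ := Submodule.exists_mem_ne_zero_of_ne_bot hI0
  let p : (Fin k → R) →ₗ[R] R := Fintype.linearCombination R g
  have hp : LinearMap.range p = I := (Fintype.range_linearCombination R g).trans hg
  let S : Submodule R (Fin k → R) := (LinearMap.ker p).map (LinearMap.lsmul R _ a)
  let M := (Fin k → R) ⧸ S
  let q : (Fin k → R) →ₗ[R] M := S.mkQ
  let π : M →ₗ[R] M ⧸ Submodule.torsion R M := (Submodule.torsion R M).mkQ
  have hπq {z w : Fin k → R} : π (q z) = π (q w) ↔ p z = p w := by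
    rw [← sub_eq_zero, ← map_sub, ← map_sub, ← sub_eq_zero (a := p z), ← map_sub]
    generalize z - w = z
    refine (Submodule.Quotient.mk_eq_zero _).trans ((Submodule.mem_torsion_iff _).trans ?_)
    constructor
    · rintro ⟨t, ht⟩
      obtain ⟨w, hw, hwt⟩ := (Submodule.Quotient.mk_eq_zero S).1
        (show q ((t : R) • z) = 0 by rw [map_smul]; exact ht)
      have h₁ : (t : R) * p z = a * p w := by
        simpa using (congrArg p hwt).symm
      rw [LinearMap.mem_ker.1 hw, mul_zero] at h₁
      exact (mul_eq_zero.1 h₁).resolve_left (nonZeroDivisors.coe_ne_zero t)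
    · intro hz
      refine ⟨⟨a, mem_nonZeroDivisors_of_ne_zero ha0⟩, ?_⟩
      exact (Submodule.Quotient.mk_eq_zero S).2 ⟨z, hz, rfl⟩
  obtain ⟨J, hJ, hJd⟩ := H M
  refine ⟨J, hJ, ?_⟩
  intro _ hdK
  obtain ⟨d, hd, rfl⟩ := (FractionalIdeal.mem_coeIdeal _).1 hdK
  obtain ⟨h, hh⟩ := hJd d hd
  have hpre {y : R} (hy : y ∈ I) : ∃ v, p v = y := by rwa [← hp] at hy
  obtain ⟨u, hu⟩ := hpre haI
  obtain ⟨x, hx⟩ := S.mkQ_surjective (h (π (q u)))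
  have hpx : p x = d * a := by
    have h₁ : π (q x) = π (q (d • u)) := by
      rw [show q x = h (π (q u)) from hx, map_smul, map_smul]
      exact LinearMap.congr_fun hh (π (q u))
    rw [hπq.1 h₁, map_smul, hu, smul_eq_mul]
  have hdiv {y : R} (hy : y ∈ I) : ∃ c : Fin k → R, y • x = a • c := by
    obtain ⟨v, hv⟩ := hpre hy
    obtain ⟨w, hw⟩ := S.mkQ_surjective (h (π (q v)))
    have h₁ : π (q (y • u)) = π (q (a • v)) := hπq.2 (by simp [hu, hv, mul_comm])
    have h₂ : q (y • x - a • w) = 0 := by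
      rw [map_sub, map_smul, map_smul, show q x = _ from hx, show q w = _ from hw, ← map_smul,
        ← map_smul, ← map_smul, ← map_smul, ← map_smul, ← map_smul, h₁, sub_self]
    obtain ⟨z, -, hz⟩ := (Submodule.Quotient.mk_eq_zero S).1 h₂
    exact ⟨z + w, by rw [smul_add]; exact (sub_eq_iff_eq_add.1 hz.symm)⟩
  have ha0' : algebraMap R K a ≠ 0 := by simpa using ha0
  have hsum : algebraMap R K d =
      ∑ j, algebraMap R K (g j) * (algebraMap R K (x j) / algebraMap R K a) := by
    have h₁ : ∑ j, x j * g j = d * a := by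
      rw [← hpx]; simp [p, Fintype.linearCombination_apply]
    have h₂ := congrArg (algebraMap R K) h₁
    rw [map_sum, map_mul] at h₂
    rw [eq_div_of_mul_eq ha0' h₂.symm, Finset.sum_div]
    exact Finset.sum_congr rfl fun j _ => by rw [map_mul]; ring
  rw [hsum]
  refine Submodule.sum_mem _ fun j _ => ?_
  refine FractionalIdeal.mul_mem_mul
    (FractionalIdeal.mem_coeIdeal_of_mem _ (hg ▸ Submodule.subset_span ⟨j, rfl⟩)) ?_
  rw [FractionalIdeal.mem_inv_iff (FractionalIdeal.coeIdeal_ne_zero.2 hI0)]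
  intro _ hyK
  obtain ⟨y, hy, rfl⟩ := (FractionalIdeal.mem_coeIdeal _).1 hyK
  obtain ⟨c, hc⟩ := hdiv hy
  refine (FractionalIdeal.mem_one_iff _).2 ⟨c j, ?_⟩
  have := congrArg (algebraMap R K) (congrFun hc j)
  simp only [Pi.smul_apply, smul_eq_mul, map_mul] at this
  field_simp
  rw [mul_comm, ← this, mul_comm]

/-- `R` is a PvMD iff for every finitely generated `R`-module `M` the
canonical exact sequence `0 → T(M) → M → M/T(M) → 0` w-splits: there is a GV-ideal
`J` such that for every `d ∈ J` there is `h : M/T(M) → M` with `π ∘ h = d·id`. -/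
theorem pvmd_iff_canonical_sequence_wsplits
    {R : Type u} [CommRing R] [IsDomain R] :
    IsPvMD R (FractionRing R) ↔
      ∀ (M : Type u) [AddCommGroup M] [Module R M] [Module.Finite R M],
        ∃ J : Ideal R, IsGVIdeal J ∧
          ∀ d ∈ J, ∃ h : (M ⧸ Submodule.torsion R M) →ₗ[R] M,
            (Submodule.torsion R M).mkQ ∘ₗ h = d • LinearMap.id := by
  refine ⟨fun hR M _ _ _ => ?_, isPvMD_of_canonical_sequence_wsplits⟩
  obtain ⟨n, i, hi⟩ := Module.Finite.exists_injective_pi (R := R) (M ⧸ Submodule.torsion R M)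
  obtain ⟨J, hJ, hJM⟩ := exists_isGVIdeal_le_finiteFreeScalars_of_injective_pi
    hR.exists_isGVIdeal_le_finiteFreeScalars_ideal n _ i hi
  refine ⟨J, hJ, fun d hd => ?_⟩
  obtain ⟨h, -, hh⟩ := exists_lift_of_mem_range_dualTensorHom
    (Submodule.torsion R M).mkQ_surjective (Module.mem_finiteFreeScalars.1 (hJM hd))
  exact ⟨h, hh⟩
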